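/- Let m be odd and a ∈ F_r^*. The number N_a(0) of x ∈ F_r^* with Tr(x) = 0 and Tr(ax²) = 0 equals p^{m-2} − 1 if Tr(a^{-1}) = 0, and equals p^{m-2} − 1 + (-1)^{((p-1)/2)·((m-1)/2)} · η(a) · η̄(Tr(a^{-1})) · (p−1) · p^{(m-3)/2} if Tr(a^{-1}) ≠ 0. -/

import Mathlib

open AddChar

/-- The quadratic character of a finite field with values in `ℂ`. -/
noncomputable abbrev complexQuadraticChar (K : Type*) [Field K] [Fintype K] [DecidableEq K] :
    MulChar K ℂ :=
  (quadraticChar K).ringHomComp (Int.castRingHom ℂ)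

lemma complexQuadraticChar_isQuadratic (K : Type*) [Field K] [Fintype K] [DecidableEq K] :
    (complexQuadraticChar K).IsQuadratic :=
  (quadraticChar_isQuadratic K).comp _

lemma complexQuadraticChar_ne_one {K : Type*} [Field K] [Fintype K] [DecidableEq K]
    (hK : ringChar K ≠ 2) : complexQuadraticChar K ≠ 1 :=
  (MulChar.ringHomComp_ne_one_iff Int.cast_injective).mpr (quadraticChar_ne_one hK)

lemma sum_addChar_mul_sq {K : Type*} [Field K] [Fintype K] [DecidableEq K]
    (hK : ringChar K ≠ 2) {ψ : AddChar K ℂ} (hψ : ψ.IsPrimitive) {c : K} (hc : c ≠ 0) :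
    ∑ x, ψ (c * x ^ 2) = quadraticChar K c * gaussSum (complexQuadraticChar K) ψ := by
  have hsum : ∑ y, ψ (c * y) = 0 := by
    simpa [mul_comm, hc] using AddChar.sum_mulShift c hψ
  calc ∑ x, ψ (c * x ^ 2)
      = ∑ y, ∑ x with x ^ 2 = y, ψ (c * x ^ 2) := (Finset.sum_fiberwise _ _ _).symm
    _ = ∑ y, ((quadraticChar K y : ℂ) + 1) * ψ (c * y) := by
        refine Finset.sum_congr rfl fun y _ ↦ ?_
        have hy : (({x : K | x ^ 2 = y} : Finset K).card : ℂ) = quadraticChar K y + 1 := by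
          have := quadraticChar_card_sqrts hK y
          rw [Set.toFinset_ofPred] at this
          exact_mod_cast this
        rw [← hy, ← nsmul_eq_mul, ← Finset.sum_const]
        refine Finset.sum_congr rfl fun x hx ↦ ?_
        rw [(Finset.mem_filter.mp hx).2]
    _ = gaussSum (complexQuadraticChar K) (ψ.mulShift (Units.mk0 c hc)) := by
        simp only [add_mul, one_mul, Finset.sum_add_distrib, hsum, add_zero]
        rfl
    _ = quadraticChar K c * gaussSum (complexQuadraticChar K) ψ := by
        rw [gaussSum_mulShift_eq, (complexQuadraticChar_isQuadratic K).inv]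
        rfl

lemma isSquare_algebraMap_iff_of_odd_finrank {k K : Type*} [Field k] [Field K] [Algebra k K]
    (h : Odd (Module.finrank k K)) {c : k} : IsSquare (algebraMap k K c) ↔ IsSquare c := by
  refine ⟨fun hc ↦ ?_, fun hc ↦ hc.map _⟩
  have := hc.map (Algebra.norm k)
  rw [Algebra.norm_algebraMap] at this
  obtain ⟨n, hn⟩ := h
  rcases eq_or_ne c 0 with rfl | h0
  · exact IsSquare.zero
  rw [hn, pow_succ, pow_mul'] at this
  have h2 : c = c ^ (2 * n + 1) / (c ^ n) ^ 2 := by field_simp; ring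
  rw [h2, pow_succ, pow_mul']
  exact this.div (IsSquare.sq _)

lemma quadraticChar_algebraMap_of_odd_finrank {k K : Type*} [Field k] [Fintype k] [DecidableEq k]
    [Field K] [Fintype K] [DecidableEq K] [Algebra k K] (h : Odd (Module.finrank k K)) (c : k) :
    quadraticChar K (algebraMap k K c) = quadraticChar k c := by
  rcases eq_or_ne c 0 with rfl | h0
  · simp
  have h1 : algebraMap k K c ≠ 0 := by simpa using h0
  by_cases hc : IsSquare c
  · rw [(quadraticChar_one_iff_isSquare h0).mpr hc,
      (quadraticChar_one_iff_isSquare h1).mpr ((isSquare_algebraMap_iff_of_odd_finrank h).mpr hc)]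
  · rw [quadraticChar_neg_one_iff_not_isSquare.mpr hc, quadraticChar_neg_one_iff_not_isSquare.mpr
      (mt (isSquare_algebraMap_iff_of_odd_finrank h).mp hc)]

lemma isSquare_algebraMap_discr {k K ι : Type*} [Field k] [Field K] [Algebra k K]
    [FiniteDimensional k K] [IsGalois k K] [Fintype ι] [DecidableEq ι]
    (b : Module.Basis ι k K) : IsSquare (algebraMap k K (Algebra.discr k b)) := by
  have hcard : Fintype.card ι = Fintype.card Gal(K/k) := by
    rw [Fintype.card_eq_nat_card (α := Gal(K/k)), IsGalois.card_aut_eq_finrank,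
      Module.finrank_eq_card_basis b]
  let e := Fintype.equivOfCardEq hcard
  let M : Matrix ι ι K := Matrix.of fun i j ↦ e i (b j)
  refine ⟨M.det, ?_⟩
  rw [Algebra.discr_def, RingHom.map_det]
  nth_rw 1 [← Matrix.det_transpose M]
  rw [← Matrix.det_mul]
  congr 1
  ext i j
  simp only [RingHom.mapMatrix_apply, Matrix.map_apply, Algebra.traceMatrix_apply,
    Algebra.traceForm_apply, trace_eq_sum_automorphisms, Matrix.mul_apply, Matrix.transpose_apply,
    M, Matrix.of_apply, map_mul]
  exact (e.sum_comp fun σ : Gal(K/k) ↦ σ (b i) * σ (b j)).symm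

lemma isPrimitive_comp_trace {k K : Type*} [Field k] [Field K] [Algebra k K]
    [FiniteDimensional k K] [Algebra.IsSeparable k K] {e : AddChar k ℂ} (he : e.IsPrimitive) :
    (e.compAddMonoidHom (Algebra.trace k K).toAddMonoidHom).IsPrimitive := by
  refine IsPrimitive.of_ne_one fun h ↦ he one_ne_zero ?_
  ext y
  obtain ⟨x, rfl⟩ := Algebra.trace_surjective k K y
  simpa using DFunLike.congr_fun h x

lemma addChar_map_sum {ι A M : Type*} [AddCommMonoid A] [CommMonoid M] (e : AddChar A M)
    (s : Finset ι) (f : ι → A) : e (∑ i ∈ s, f i) = ∏ i ∈ s, e (f i) := by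
  simpa [toMonoidHom_apply, ← ofAdd_sum] using
    map_prod e.toMonoidHom (fun i ↦ Multiplicative.ofAdd (f i)) s

lemma gaussSum_comp_trace_of_odd_finrank {k K : Type*} [Field k] [Fintype k] [DecidableEq k]
    [Field K] [Fintype K] [DecidableEq K] [Algebra k K] (hk : ringChar k ≠ 2)
    (h : Odd (Module.finrank k K)) {e : AddChar k ℂ} (he : e.IsPrimitive) :
    gaussSum (complexQuadraticChar K) (e.compAddMonoidHom (Algebra.trace k K).toAddMonoidHom)
      = gaussSum (complexQuadraticChar k) e ^ Module.finrank k K := by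
  have hK : ringChar K ≠ 2 := by rwa [← Algebra.ringChar_eq k K]
  have : Invertible (2 : k) := invertibleOfNonzero (Ring.two_ne_zero hk)
  obtain ⟨v, hv⟩ := LinearMap.BilinForm.exists_orthogonal_basis
    (B := Algebra.traceForm k K) (LinearMap.BilinForm.isSymm_iff.mp (Algebra.traceForm_isSymm k))
  set d : Fin (Module.finrank k K) → k := fun i ↦ Algebra.trace k K (v i * v i) with hd
  have hdiscr : Algebra.discr k v = ∏ i, d i := by
    rw [Algebra.discr_def, ← Matrix.det_diagonal]
    congr 1
    ext i j
    rcases eq_or_ne i j with rfl | hij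
    · simp [hd, Algebra.traceMatrix_apply, Algebra.traceForm_apply]
    · rw [Matrix.diagonal_apply_ne _ hij]
      exact hv hij
  have hdiscr0 : ∏ i, d i ≠ 0 := hdiscr ▸ Algebra.discr_not_zero_of_basis k v
  have hd0 (i) : d i ≠ 0 := Finset.prod_ne_zero_iff.mp hdiscr0 i (Finset.mem_univ i)
  have hsq : quadraticChar k (∏ i, d i) = 1 := by
    rw [quadraticChar_one_iff_isSquare hdiscr0, ← isSquare_algebraMap_iff_of_odd_finrank h,
      ← hdiscr]
    exact isSquare_algebraMap_discr v
  have htr (c : Fin (Module.finrank k K) → k) :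
      Algebra.trace k K (v.equivFun.symm c ^ 2) = ∑ i, d i * c i ^ 2 := by
    rw [v.equivFun_symm_apply, sq, Finset.sum_mul_sum, map_sum]
    refine Finset.sum_congr rfl fun i _ ↦ ?_
    rw [map_sum, Finset.sum_eq_single i]
    · simp [hd]; ring
    · intro j _ hji
      have : Algebra.trace k K (v i * v j) = 0 := hv hji.symm
      simp [this]
    · simp
  have h1 := sum_addChar_mul_sq hK (isPrimitive_comp_trace (K := K) he) one_ne_zero
  simp only [one_mul, map_one, Int.cast_one] at h1
  rw [← h1, ← v.equivFun.symm.toEquiv.sum_comp]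
  have hprod (c : Fin (Module.finrank k K) → k) :
      e.compAddMonoidHom (Algebra.trace k K).toAddMonoidHom (v.equivFun.symm.toEquiv c ^ 2)
        = ∏ i, e (d i * c i ^ 2) := by
    rw [← addChar_map_sum, ← htr]
    rfl
  simp_rw [hprod]
  rw [← Fintype.prod_sum fun i z ↦ e (d i * z ^ 2)]
  simp_rw [sum_addChar_mul_sq hk he (hd0 _), Finset.prod_mul_distrib]
  rw [← Int.cast_prod, ← map_prod, hsq]
  simp

lemma sum_addChar_quadratic {K : Type*} [Field K] [Fintype K] [DecidableEq K]
    (hK : ringChar K ≠ 2) {ψ : AddChar K ℂ} (hψ : ψ.IsPrimitive) {c : K} (hc : c ≠ 0) (b : K) :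
    ∑ x, ψ (c * x ^ 2 + b * x)
      = ψ (-(b ^ 2 / (4 * c))) * (quadraticChar K c * gaussSum (complexQuadraticChar K) ψ) := by
  have h2 : (2 : K) ≠ 0 := Ring.two_ne_zero hK
  have h4 : (4 : K) ≠ 0 := by
    rw [show (4 : K) = 2 * 2 by norm_num]
    exact mul_ne_zero h2 h2
  rw [← sum_addChar_mul_sq hK hψ hc, Finset.mul_sum,
    ← Equiv.sum_comp (Equiv.addRight (-(b / (2 * c)))) fun x ↦ ψ (c * x ^ 2 + b * x)]
  refine Finset.sum_congr rfl fun x _ ↦ ?_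
  rw [← map_add_eq_mul, Equiv.coe_addRight]
  congr 1
  field_simp
  ring

lemma card_sq_mul_card_trace_eq_zero {k K : Type*} [Field k] [Fintype k] [DecidableEq k] [Field K]
    [Fintype K] [Algebra k K] {e : AddChar k ℂ}
    (he : e.IsPrimitive) (a : K) :
    (Fintype.card k : ℂ) ^ 2 *
        ({x : K | Algebra.trace k K x = 0 ∧ Algebra.trace k K (a * x ^ 2) = 0} : Finset K).card
      = ∑ y : k, ∑ z : k, ∑ x : K, e (Algebra.trace k K
          (algebraMap k K y * a * x ^ 2 + algebraMap k K z * x)) := by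
  have hx (x : K) : ∑ y : k, ∑ z : k, e (Algebra.trace k K
      (algebraMap k K y * a * x ^ 2 + algebraMap k K z * x))
      = if Algebra.trace k K x = 0 ∧ Algebra.trace k K (a * x ^ 2) = 0
        then (Fintype.card k : ℂ) ^ 2 else 0 := by
    have hyz (y z : k) : e (Algebra.trace k K
        (algebraMap k K y * a * x ^ 2 + algebraMap k K z * x))
        = e (y * Algebra.trace k K (a * x ^ 2)) * e (z * Algebra.trace k K x) := by
      rw [← map_add_eq_mul, map_add, mul_assoc, ← Algebra.smul_def, ← Algebra.smul_def, map_smul,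
        map_smul, smul_eq_mul, smul_eq_mul]
    simp_rw [hyz, ← Finset.mul_sum, ← Finset.sum_mul, AddChar.sum_mulShift _ he]
    split_ifs <;> simp_all [sq]
  calc _ = ∑ x : K, ∑ y : k, ∑ z : k, e (Algebra.trace k K
      (algebraMap k K y * a * x ^ 2 + algebraMap k K z * x)) := by
        simp_rw [hx, ← Finset.sum_filter, Finset.sum_const, nsmul_eq_mul]
        ring
    _ = _ := by
        rw [Finset.sum_comm]
        refine Finset.sum_congr rfl fun y _ ↦ Finset.sum_comm

/-- For `a ≠ 0` and `K/k` of odd degree, the number of `x` with `Tr x = Tr (a x²) = 0` in terms of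
Gauss sums of the quadratic characters. -/
lemma card_sq_mul_card_trace_eq_zero_of_odd_finrank {k K : Type*} [Field k] [Fintype k]
    [DecidableEq k] [Field K] [Fintype K] [DecidableEq K] [Algebra k K] (hk : ringChar k ≠ 2)
    (h : Odd (Module.finrank k K)) {e : AddChar k ℂ} (he : e.IsPrimitive) {a : K} (ha : a ≠ 0) :
    (Fintype.card k : ℂ) ^ 2 *
        ({x : K | Algebra.trace k K x = 0 ∧ Algebra.trace k K (a * x ^ 2) = 0} : Finset K).card
      = Fintype.card K + quadraticChar K a * quadraticChar k (-Algebra.trace k K a⁻¹)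
        * (Fintype.card k - 1) * gaussSum (complexQuadraticChar k) e ^ (Module.finrank k K + 1) := by
  have hK : ringChar K ≠ 2 := by rwa [← Algebra.ringChar_eq k K]
  have h2 : (2 : k) ≠ 0 := Ring.two_ne_zero hk
  set t := Algebra.trace k K a⁻¹ with ht
  set g := gaussSum (complexQuadraticChar k) e with hg
  have hψ := isPrimitive_comp_trace (K := K) he
  rw [card_sq_mul_card_trace_eq_zero he, ← Finset.add_sum_erase _ _ (Finset.mem_univ (0 : k))]
  congr 1
  · rw [Finset.sum_eq_single 0]
    · simp
    · intro z _ hz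
      have := AddChar.sum_mulShift (algebraMap k K z) hψ
      rw [if_neg (by simpa using hz)] at this
      simpa [mul_comm] using this
    · simp
  have hz (y z : k) (hy0 : y ≠ 0) : ∑ x : K, e (Algebra.trace k K
      (algebraMap k K y * a * x ^ 2 + algebraMap k K z * x))
      = e (-t / (4 * y) * z ^ 2) * (quadraticChar K a * quadraticChar k y
        * g ^ Module.finrank k K) := by
    have hya : algebraMap k K y * a ≠ 0 := mul_ne_zero (by simpa using hy0) ha
    refine (sum_addChar_quadratic hK hψ hya (algebraMap k K z)).trans ?_
    rw [gaussSum_comp_trace_of_odd_finrank hk h he, map_mul,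
      quadraticChar_algebraMap_of_odd_finrank h]
    congr 1
    · change e (Algebra.trace k K _) = _
      have : -((algebraMap k K z) ^ 2 / (4 * (algebraMap k K y * a)))
          = (-z ^ 2 / (4 * y)) • a⁻¹ := by
        simp only [Algebra.smul_def, map_div₀, map_neg, map_pow, map_mul, map_ofNat]
        rw [← mul_assoc, ← div_div, neg_div, div_eq_mul_inv _ a, neg_mul]
      rw [this, map_smul, smul_eq_mul, ← ht]
      congr 1
      ring
    · push_cast
      ring
  have hz' (y : k) (hy0 : y ∈ Finset.univ.erase 0) := Finset.sum_congr (rfl : Finset.univ = _)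
    fun z _ ↦ hz y z (Finset.ne_of_mem_erase hy0)
  rw [Finset.sum_congr rfl hz']
  simp_rw [← Finset.sum_mul]
  rcases eq_or_ne t 0 with h0 | h0
  · have hsum : ∑ y ∈ Finset.univ.erase (0 : k), (quadraticChar k y : ℂ) = 0 := by
      rw [Finset.sum_erase _ (by simp)]
      exact_mod_cast quadraticChar_sum_zero hk
    simp only [h0, neg_zero, zero_div, zero_mul, map_zero_eq_one, ← Finset.mul_sum,
      ← Finset.sum_mul, hsum]
    simp
  · have hy (y : k) (hy0 : y ∈ Finset.univ.erase 0) : (∑ z : k, e (-t / (4 * y) * z ^ 2))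
        * (quadraticChar K a * quadraticChar k y * g ^ Module.finrank k K)
        = quadraticChar K a * quadraticChar k (-t) * g ^ (Module.finrank k K + 1) := by
      replace hy0 : y ≠ 0 := Finset.ne_of_mem_erase hy0
      have h4 : (4 : k) = 2 * 2 := by norm_num
      have h4y : 4 * y ≠ 0 := h4 ▸ mul_ne_zero (mul_ne_zero h2 h2) hy0
      rw [sum_addChar_mul_sq hk he (div_ne_zero (neg_ne_zero.mpr h0) h4y)]
      have hq : quadraticChar k (-t / (4 * y)) * quadraticChar k y = quadraticChar k (-t) := by
        rw [← map_mul, show -t / (4 * y) * y = -t * (2⁻¹) ^ 2 by rw [h4]; field_simp, map_mul,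
          quadraticChar_sq_one' (inv_ne_zero h2), mul_one]
      rw [← hq, ← hg]
      push_cast
      ring
    rw [Finset.sum_congr rfl hy, Finset.sum_const, Finset.card_erase_of_mem (Finset.mem_univ _),
      Finset.card_univ, nsmul_eq_mul, Nat.cast_sub Fintype.card_pos]
    push_cast
    ring

theorem stmt_18 (p m : ℕ) [Fact p.Prime] (hp2 : p ≠ 2) (hm : 2 ≤ m) (hmodd : Odd m)
    (F : Type) [Field F] [Fintype F] [DecidableEq F] [Algebra (ZMod p) F]
    (hcard : Fintype.card F = p ^ m)
    (a : F) (ha : a ≠ 0) :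
    (Algebra.trace (ZMod p) F a⁻¹ = 0 →
      (({x : F | x ≠ 0 ∧ Algebra.trace (ZMod p) F x = 0 ∧
          Algebra.trace (ZMod p) F (a * x ^ 2) = 0}).ncard : ℤ)
        = (p : ℤ) ^ (m - 2) - 1) ∧
    (Algebra.trace (ZMod p) F a⁻¹ ≠ 0 →
      (({x : F | x ≠ 0 ∧ Algebra.trace (ZMod p) F x = 0 ∧
          Algebra.trace (ZMod p) F (a * x ^ 2) = 0}).ncard : ℤ)
        = (p : ℤ) ^ (m - 2) - 1
          + (-1) ^ (((p - 1) / 2) * ((m - 1) / 2)) * quadraticChar F a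
            * quadraticChar (ZMod p) (Algebra.trace (ZMod p) F a⁻¹)
            * ((p : ℤ) - 1) * (p : ℤ) ^ ((m - 3) / 2)) := by
  have hp : p.Prime := Fact.out
  have hk : ringChar (ZMod p) ≠ 2 := by rwa [ZMod.ringChar_zmod_n]
  have hpmod : p % 2 = 1 := hp.mod_two_eq_one_iff_ne_two.mpr hp2
  have hfin : Module.finrank (ZMod p) F = m := by
    have := Module.card_eq_pow_finrank (K := ZMod p) (V := F)
    rw [hcard, ZMod.card] at this
    exact (Nat.pow_right_injective hp.two_le this).symm
  obtain ⟨j, rfl⟩ : ∃ j, m = 2 * j + 3 := by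
    obtain ⟨i, hi⟩ := hmodd
    exact ⟨i - 1, by omega⟩
  set t := Algebra.trace (ZMod p) F a⁻¹ with ht
  set S : Finset F :=
    {x | Algebra.trace (ZMod p) F x = 0 ∧ Algebra.trace (ZMod p) F (a * x ^ 2) = 0} with hS
  have hset : (({x : F | x ≠ 0 ∧ Algebra.trace (ZMod p) F x = 0 ∧
      Algebra.trace (ZMod p) F (a * x ^ 2) = 0}).ncard : ℤ) = S.card - 1 := by
    have h0 : (0 : F) ∈ S := by simp [hS]
    have : {x : F | x ≠ 0 ∧ Algebra.trace (ZMod p) F x = 0 ∧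
        Algebra.trace (ZMod p) F (a * x ^ 2) = 0} = S.erase 0 := by
      ext x
      simp [hS, and_comm]
    rw [this, Set.ncard_coe_finset, Finset.card_erase_of_mem h0,
      Nat.cast_sub (Finset.card_pos.mpr ⟨0, h0⟩), Nat.cast_one]
  have hχ : quadraticChar (ZMod p) (-1) = (-1) ^ ((p - 1) / 2) := by
    rw [quadraticChar_neg_one hk, ZMod.card, ZMod.χ₄_eq_neg_one_pow hpmod]
    congr 1
    omega
  have he := ZMod.isPrimitive_stdAddChar p
  have hg := gaussSum_sq (complexQuadraticChar_ne_one hk)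
    (complexQuadraticChar_isQuadratic (ZMod p)) he
  have hcount := card_sq_mul_card_trace_eq_zero_of_odd_finrank hk (hfin ▸ hmodd) he ha
  rw [hfin, hcard, show 2 * j + 3 + 1 = 2 * (j + 2) by ring, pow_mul, hg, ZMod.card, ← ht, ← hS,
    ← neg_one_mul t, map_mul] at hcount
  have hcountZ : (p : ℤ) ^ 2 * S.card = p ^ (2 * j + 3) + quadraticChar F a *
      (quadraticChar (ZMod p) (-1) * quadraticChar (ZMod p) t) * (p - 1) *
      (quadraticChar (ZMod p) (-1) * p) ^ (j + 2) := by
    have hcast : complexQuadraticChar (ZMod p) (-1) = (quadraticChar (ZMod p) (-1) : ℤ) := rfl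
    rw [hcast] at hcount
    exact_mod_cast hcount
  have hsq : quadraticChar (ZMod p) (-1) ^ 2 = 1 := quadraticChar_sq_one (by simp)
  have hcard' : (S.card : ℤ) = p ^ (2 * j + 1) + (-1) ^ ((p - 1) / 2 * (j + 1)) *
      quadraticChar F a * quadraticChar (ZMod p) t * (p - 1) * p ^ j := by
    refine mul_left_cancel₀ (pow_ne_zero 2 (Nat.cast_ne_zero.mpr hp.ne_zero : (p : ℤ) ≠ 0)) ?_
    rw [hcountZ, pow_mul, ← hχ]
    linear_combination (quadraticChar F a : ℤ) * quadraticChar (ZMod p) t * (p - 1) * p ^ (j + 2) *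
      quadraticChar (ZMod p) (-1) ^ (j + 1) * hsq
  have e1 : 2 * j + 3 - 2 = 2 * j + 1 := by omega
  have e2 : (2 * j + 3 - 1) / 2 = j + 1 := by omega
  have e3 : (2 * j + 3 - 3) / 2 = j := by omega
  rw [hset, hcard', e1, e2, e3]
  refine ⟨fun h0 ↦ ?_, fun _ ↦ ?_⟩
  · simp [h0]
  · ring
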